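/- Let T_0 = 2π/(2h+1) with h ∈ ℕ even and h ≥ 2. Then T_opt(T_0) = 3π − T_0/2; in particular the set { t > 0 : μ((D(T_0,t))ᶜ) = 0 } is nonempty. -/

import Mathlib

open MeasureTheory Set Real Filter Topology

noncomputable section

instance : Fact (0 < 2 * Real.pi) := ⟨by positivity⟩

/-- λ_k: 0 for even k, π for odd k. -/
def lam (k : ℕ) : ℝ := if Even k then 0 else Real.pi

/-- Covered set D(T₀, t) ⊆ ℝ/(2πℤ): the union over k of the projections of the
observation intervals (k·T₀, min((k+1)·T₀, t)) translated by −λ_k. -/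
def coveredSet (T0 t : ℝ) : Set (AddCircle (2 * Real.pi)) :=
  ⋃ k : ℕ, (fun a : ℝ => ((a - lam k : ℝ) : AddCircle (2 * Real.pi))) ''
    Set.Ioo ((k : ℝ) * T0) (min (((k : ℝ) + 1) * T0) t)

/-- Optimal control time T_opt(T₀). -/
def Topt (T0 : ℝ) : ℝ :=
  sInf { t : ℝ | 0 < t ∧ volume (coveredSet T0 t)ᶜ = 0 }

lemma aux_upper (g : ℕ) (u : ℝ) (hu : 0 < u) (hpi : Real.pi = (4 * g + 1) * u) :
    volume (coveredSet (2 * u) ((12 * g + 2) * u))ᶜ = 0 := by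
  have : NullSingletonClass (volume : Measure (AddCircle (2 * Real.pi))) := by
    refine ⟨fun x => ?_⟩
    have hx := AddCircle.volume_closedBall (T := 2 * Real.pi) (x := x) 0
    rw [Metric.closedBall_zero] at hx
    rw [hx, ENNReal.ofReal_eq_zero]
    simp
  have hc : (Set.range (fun n : ℕ => ((n * u : ℝ) : AddCircle (2 * Real.pi)))).Countable :=
    Set.countable_range _
  refine measure_mono_null ?_ (hc.measure_zero volume)
  intro y hy
  by_contra hny
  apply hy
  obtain ⟨s, ⟨hs0, hs1⟩, rfl⟩ : ∃ s ∈ Set.Ico (0:ℝ) (0 + 2 * Real.pi), (s : AddCircle (2 * Real.pi)) = y := by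
    have := AddCircle.coe_image_Ico_eq (2 * Real.pi) 0
    have h2 : y ∈ (Set.univ : Set (AddCircle (2 * Real.pi))) := trivial
    rw [← this] at h2
    exact h2
  have key : ∀ (k : ℕ) (m : ℤ), k ≤ 6 * g → 
      (2 * k) * u < s + m * (2 * Real.pi) + lam k → s + m * (2 * Real.pi) + lam k < (2 * k + 2) * u →
      (s : AddCircle (2 * Real.pi)) ∈ coveredSet (2 * u) ((12 * g + 2) * u) := by
    intro k m hk h1 h2
    refine Set.mem_iUnion.2 ⟨k, s + m * (2 * Real.pi) + lam k, ⟨by linarith, ?_⟩, ?_⟩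
    · have hk' : (k : ℝ) ≤ 6 * g := by exact_mod_cast hk
      refine lt_min (by linarith) ?_
      nlinarith
    · have : s + m * (2 * Real.pi) + lam k - lam k = s + m • (2 * Real.pi) := by
        simp
      simp only [this]
      rw [AddCircle.coe_add, AddCircle.coe_zsmul, AddCircle.coe_period]
      simp
  set n := ⌊s / u⌋₊ with hn
  have hsu : 0 ≤ s / u := by positivity
  have hn1 : (n : ℝ) * u ≤ s := by
    have := Nat.floor_le hsu
    rwa [le_div_iff₀ hu] at this
  have hn2 : s < (n + 1 : ℝ) * u := by
    have := Nat.lt_floor_add_one (s / u)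
    rwa [div_lt_iff₀ hu] at this
  have hn1' : (n : ℝ) * u < s := by
    refine lt_of_le_of_ne hn1 fun he => hny ⟨n, ?_⟩
    simp only [he]
  have hn3 : n < 8 * g + 2 := by
    have : (n : ℝ) * u < (8 * g + 2 : ℝ) * u := by
      rw [hpi] at hs1; linarith
    have := lt_of_mul_lt_mul_right this hu.le
    exact_mod_cast this
  -- final placement lemma
  have key2 : ∀ (k : ℕ) (m e : ℤ), k ≤ 6 * g → (lam k = e * ((4 * g + 1) * u)) →
      (2 * k : ℤ) ≤ n + (2 * m + e) * (4 * g + 1) → (n + (2 * m + e) * (4 * g + 1) : ℤ) ≤ 2 * k + 1 →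
      (s : AddCircle (2 * Real.pi)) ∈ coveredSet (2 * u) ((12 * g + 2) * u) := by
    intro k m e hk hl h1 h2
    have h1' : (2 * k : ℝ) ≤ n + (2 * m + e) * (4 * g + 1) := by exact_mod_cast h1
    have h2' : (n + (2 * m + e) * (4 * g + 1) : ℝ) ≤ 2 * k + 1 := by exact_mod_cast h2
    have h1'' := mul_le_mul_of_nonneg_right h1' hu.le
    have h2'' := mul_le_mul_of_nonneg_right h2' hu.le
    apply key k m hk
    · rw [hl, hpi]; nlinarith
    · rw [hl, hpi]; nlinarith
  have hev : ∀ k : ℕ, k % 2 = 0 → lam k = (0 : ℤ) * ((4 * g + 1) * u) := by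
    intro k hk
    simp [lam, Nat.even_iff, hk]
  have hod : ∀ k : ℕ, k % 2 = 1 → lam k = (1 : ℤ) * ((4 * g + 1) * u) := by
    intro k hk
    simp [lam, Nat.even_iff, hk, hpi]
  by_cases c1 : n % 4 < 2
  · exact key2 (n / 2) 0 0 (by omega) (hev _ (by omega)) (by omega) (by omega)
  by_cases c2 : n < 4 * g
  · exact key2 ((n + 8 * g + 2) / 2) 1 0 (by omega) (hev _ (by omega)) (by omega) (by omega)
  by_cases c3 : n % 4 = 2
  · exact key2 ((n + 4 * g + 1) / 2) 0 1 (by omega) (hod _ (by omega)) (by omega) (by omega)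
  · exact key2 ((n - 4 * g - 1) / 2) (-1) 1 (by omega) (hod _ (by omega)) (by omega) (by omega)

lemma aux_lower (g : ℕ) (u : ℝ) (hu : 0 < u) (hpi : Real.pi = (4 * g + 1) * u) (t : ℝ)
    (ht : t < (12 * g + 2) * u) :
    volume (coveredSet (2 * u) t)ᶜ ≠ 0 := by
  set b : ℝ := max t ((12 * g + 1) * u) with hb
  have hbt : t ≤ b := le_max_left _ _
  have hbu : (12 * g + 1) * u ≤ b := le_max_right _ _
  have hb2 : b < (12 * g + 2) * u := max_lt ht (by nlinarith)
  set U : Set (AddCircle (2 * Real.pi)) := (fun x : ℝ => (x : AddCircle (2 * Real.pi))) ''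
    Set.Ioo (b - (8 * g + 2) * u) (4 * g * u) with hU
  have hUo : IsOpen U := QuotientAddGroup.isOpenMap_coe _ isOpen_Ioo
  have hUn : U.Nonempty := (Set.nonempty_Ioo.2 (by nlinarith)).image _
  have hpos := hUo.measure_pos volume hUn
  intro h0
  refine hpos.ne' (measure_mono_null ?_ h0)
  rintro _ ⟨x, ⟨hx1, hx2⟩, rfl⟩ hmem
  obtain ⟨k, a, ⟨ha1, ha2⟩, hax⟩ := Set.mem_iUnion.1 hmem
  have ha3 := lt_of_lt_of_le ha2 (min_le_left _ _)
  have ha4 := lt_of_lt_of_le ha2 (min_le_right _ _)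
  have hax' : ((a - lam k : ℝ) : AddCircle (2 * Real.pi)) = (x : AddCircle (2 * Real.pi)) := hax
  obtain ⟨m, hm⟩ : ∃ m : ℤ, a - lam k = x + m * (2 * Real.pi) := by
    rw [← sub_eq_zero, ← AddCircle.coe_sub, AddCircle.coe_eq_zero_iff] at hax'
    obtain ⟨m, hm⟩ := hax'
    refine ⟨m, ?_⟩
    rw [zsmul_eq_mul] at hm
    linarith
  have hk0 : (0 : ℝ) ≤ k * (2 * u) := by positivity
  have hgu : 0 ≤ g * u := by positivity
  have hl0 : 0 ≤ lam k := by unfold lam; split_ifs <;> linarith [Real.pi_pos]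
  have hl1 : lam k ≤ Real.pi := by unfold lam; split_ifs <;> linarith [Real.pi_pos]
  have hm1 : m < 1 := by
    by_contra hc
    have : (1 : ℝ) ≤ m := by exact_mod_cast not_lt.1 hc
    have := mul_le_mul_of_nonneg_right this (by positivity : 0 ≤ 2 * Real.pi)
    nlinarith
  have hm2 : -1 < m := by
    by_contra hc
    have : (m : ℝ) ≤ -1 := by exact_mod_cast not_lt.1 hc
    have := mul_le_mul_of_nonneg_right this (by positivity : 0 ≤ 2 * Real.pi)
    nlinarith
  have hm0 : m = 0 := by omega
  subst hm0
  have hcmp : ∀ p q : ℕ, (p : ℝ) * u < q * u → p < q := by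
    intro p q hpq
    exact_mod_cast lt_of_mul_lt_mul_right hpq hu.le
  rcases Nat.even_or_odd k with hk | hk
  · have hl : lam k = 0 := by simp [lam, hk]
    have e1 := hcmp (2 * k) (4 * g) (by push_cast; push_cast at hm; linarith)
    have e2 := hcmp (4 * g) (2 * k + 3) (by push_cast; push_cast at hm; linarith)
    obtain ⟨j, rfl⟩ := hk
    omega
  · have hl : lam k = Real.pi := by simp [lam, Nat.not_even_iff_odd.2 hk]
    have e1 := hcmp (2 * k) (8 * g + 1) (by push_cast; push_cast at hm; linarith)
    have e2 := hcmp (8 * g) (2 * k + 2) (by push_cast; push_cast at hm; linarith)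
    obtain ⟨j, rfl⟩ := hk
    omega

/-- Lemma 1.7 iii): if T₀ = 2π/(2h+1) with h even, h ≥ 2, then the system is
observable and T_opt = 3π − T₀/2. -/
theorem stmt_10 (h : ℕ) (hhe : Even h) (hh : 2 ≤ h) (T0 : ℝ)
    (hT0 : T0 = 2 * Real.pi / (2 * h + 1)) :
    { t : ℝ | 0 < t ∧ volume (coveredSet T0 t)ᶜ = 0 }.Nonempty ∧
      Topt T0 = 3 * Real.pi - T0 / 2 := by
  obtain ⟨g, rfl⟩ := hhe
  have hpp := Real.pi_pos
  obtain ⟨u, rfl⟩ : ∃ u, T0 = 2 * u := ⟨T0 / 2, by ring⟩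
  have hpi : Real.pi = (4 * g + 1) * u := by
    push_cast at hT0
    have : (2 * ((g : ℝ) + g) + 1) ≠ 0 := by positivity
    rw [eq_div_iff this] at hT0
    linarith
  have hu : 0 < u := by
    have : (0 : ℝ) < 4 * g + 1 := by positivity
    rw [hpi] at hpp
    exact pos_of_mul_pos_right hpp this.le
  have hle : IsLeast { t : ℝ | 0 < t ∧ volume (coveredSet (2 * u) t)ᶜ = 0 }
      ((12 * g + 2) * u) := by
    refine ⟨⟨by positivity, aux_upper g u hu hpi⟩, ?_⟩
    rintro t ⟨_, ht⟩
    by_contra hlt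
    exact aux_lower g u hu hpi t (not_le.1 hlt) ht
  refine ⟨⟨_, hle.1⟩, ?_⟩
  rw [Topt, hle.csInf_eq]
  linarith
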